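/- Let x ∈ S_n be a Grassmannian permutation of type (k,n) and let λ be the Young diagram contained in the k×(n−k) rectangle with vert(λ) = x({1,…,k}). Let b = (r,c) be a cell of λ that is λ-frozen, i.e., (r,c) is a cell of λ but (r+1,c+1) is not a cell of λ. Set ℓ := k+c−r and let w_b be the partial columnar word of λ at b. Then w_b({1,…,ℓ}) = x^{-1}({1,…,ℓ}). -/

import Mathlib

/-- `x` fixes every point outside `{1, …, n}`. -/
def fixesOutside (n : ℕ) (x : Equiv.Perm ℕ) : Prop :=
  ∀ i, i ∉ Finset.Icc 1 n → x i = i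

/-- `x` is a Grassmannian permutation of type `(k, n)`:
`x(1) < ⋯ < x(k)` and `x(k+1) < ⋯ < x(n)`. -/
def isGrassmannian (n k : ℕ) (x : Equiv.Perm ℕ) : Prop :=
  fixesOutside n x ∧
  (∀ i j, 1 ≤ i → i < j → j ≤ k → x i < x j) ∧
  (∀ i j, k + 1 ≤ i → i < j → j ≤ n → x i < x j)

/-- `lam` is a Young diagram contained in the `k × (n-k)` rectangle. -/
def isYoung (n k : ℕ) (lam : ℕ → ℕ) : Prop :=
  lam 1 ≤ n - k ∧ ∀ r, 1 ≤ r → r < k → lam (r + 1) ≤ lam r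

/-- `vert(λ) = {λ_{k+1−i} + i : 1 ≤ i ≤ k}`. -/
def vert (k : ℕ) (lam : ℕ → ℕ) : Finset ℕ :=
  (Finset.Icc 1 k).image fun i => lam (k + 1 - i) + i

/-- the height of column `j` of the Young diagram `lam` (with `k` rows). -/
def colHeight (k : ℕ) (lam : ℕ → ℕ) (j : ℕ) : ℕ :=
  ((Finset.Icc 1 k).filter fun i => j ≤ lam i).card

/-- the partial columnar word `w_b` of `lam` at the cell `b = (r, c)`. -/
def colWord (k : ℕ) (lam : ℕ → ℕ) (r c : ℕ) : Equiv.Perm ℕ :=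
  (((List.range' 1 (c - 1)).flatMap fun j =>
      (List.range' 1 (colHeight k lam j)).map fun i =>
        Equiv.swap (k + j - i) (k + j - i + 1)) ++
    ((List.range' 1 r).map fun i =>
        Equiv.swap (k + c - i) (k + c - i + 1))).prod

/-- The descending product `s_{m-1} s_{m-2} ⋯ s_{m-h}` is the cycle moving `m - h` up to `m`. -/
theorem prod_descending_swaps_apply (m h : ℕ) (hm : h < m) (p : ℕ) :
    ((List.range' 1 h).map fun i => Equiv.swap (m - i) (m - i + 1)).prod p =
      if p = m - h then m else if m - h < p ∧ p ≤ m then p - 1 else p := by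
  induction h generalizing p with
  | zero =>
    simp only [List.range'_zero, List.map_nil, List.prod_nil, Equiv.Perm.one_apply]
    split_ifs <;> omega
  | succ h ih =>
    rw [List.range'_1_concat, List.map_append, List.prod_append, Equiv.Perm.mul_apply, ih (by omega)]
    simp only [List.map_cons, List.map_nil, List.prod_singleton, Equiv.swap_apply_def]
    split_ifs <;> omega

theorem image_prod_descending_swaps (m h t : ℕ) (hm : h < m) (ht : m - h ≤ t + 1) (htm : t < m) :
    (Finset.Icc 1 (t + 1)).image
        ⇑((List.range' 1 h).map fun i => Equiv.swap (m - i) (m - i + 1)).prod =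
      insert m (Finset.Icc 1 t) := by
  apply Finset.eq_of_subset_of_card_le
  · intro a
    simp only [Finset.mem_image, prod_descending_swaps_apply m h hm, Finset.mem_insert,
      Finset.mem_Icc]
    rintro ⟨p, hp, rfl⟩
    split_ifs <;> omega
  · rw [Finset.card_image_of_injective _ (Equiv.injective _)]
    exact (Finset.card_insert_le _ _).trans (by simp)

/-- A product of `d` columns, each of height between `k - q` and `k`, maps `{1, …, q + d}` to
`{1, …, q} ∪ {k + 1, …, k + d}`. -/
theorem image_prod_columns (k q d : ℕ) (hq : q ≤ k) (h : ℕ → ℕ)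
    (hle : ∀ j, h j ≤ k) (hge : ∀ j, 1 ≤ j → j ≤ d → k - q ≤ h j) :
    (Finset.Icc 1 (q + d)).image
        ⇑((List.range' 1 d).flatMap fun j => (List.range' 1 (h j)).map fun i =>
          Equiv.swap (k + j - i) (k + j - i + 1)).prod =
      Finset.Icc 1 q ∪ Finset.Icc (k + 1) (k + d) := by
  induction d with
  | zero => simp
  | succ d ih =>
    have hd := hge (d + 1) (by omega) le_rfl
    have hd' := hle (d + 1)
    rw [List.range'_1_concat, List.flatMap_append, List.prod_append, Equiv.Perm.coe_mul,
      ← Finset.image_image, List.flatMap_singleton, add_comm 1 d, ← add_assoc q d 1,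
      image_prod_descending_swaps _ _ _ (by omega) (by omega) (by omega), Finset.image_insert,
      ih fun j h1 h2 => hge j h1 (by omega)]
    have hfix : ((List.range' 1 d).flatMap fun j => (List.range' 1 (h j)).map fun i =>
        Equiv.swap (k + j - i) (k + j - i + 1)).prod (k + (d + 1)) = k + (d + 1) := by
      rw [← Equiv.Perm.smul_def, ← MulAction.mem_stabilizer_iff]
      apply Subgroup.list_prod_mem
      intro s hs
      simp only [List.mem_flatMap, List.mem_map, List.mem_range'_1] at hs
      obtain ⟨j, hj, i, hi, rfl⟩ := hs
      have := hle j
      rw [MulAction.mem_stabilizer_iff, Equiv.Perm.smul_def]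
      exact Equiv.swap_apply_of_ne_of_ne (by omega) (by omega)
    rw [hfix]
    ext a
    simp only [Finset.mem_insert, Finset.mem_union, Finset.mem_Icc]
    omega

/-- A strictly increasing function on `{1, …, k}` is determined by its image. -/
theorem eqOn_Icc_of_strictMonoOn_of_image_eq (k : ℕ) (f g : ℕ → ℕ)
    (hf : StrictMonoOn f (Set.Icc 1 k)) (hg : StrictMonoOn g (Set.Icc 1 k))
    (hfg : (Finset.Icc 1 k).image f = (Finset.Icc 1 k).image g) :
    Set.EqOn f g (Set.Icc 1 k) := by
  have aux : ∀ (f g : ℕ → ℕ) (i : ℕ), StrictMonoOn f (Set.Icc 1 k) →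
      StrictMonoOn g (Set.Icc 1 k) → (Finset.Icc 1 k).image f = (Finset.Icc 1 k).image g →
      i ∈ Set.Icc 1 k → (∀ j < i, j ∈ Set.Icc 1 k → f j = g j) → g i ≤ f i := by
    intro f g i hf hg hfg hi ih
    have hmem : f i ∈ (Finset.Icc 1 k).image g :=
      hfg ▸ Finset.mem_image_of_mem f (Finset.mem_Icc.2 hi)
    obtain ⟨j, hj, hji⟩ := Finset.mem_image.1 hmem
    rw [Finset.mem_Icc] at hj
    rcases lt_or_ge j i with hlt | hge
    · have := hf hj hi hlt
      have := ih j hlt hj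
      omega
    · rw [← hji]
      exact hg.monotoneOn hi hj hge
  intro i
  induction i using Nat.strong_induction_on with
  | _ i ih =>
    intro hi
    exact le_antisymm (aux g f i hg hf hfg.symm hi fun j hj hj' => (ih j hj hj').symm)
      (aux f g i hf hg hfg hi ih)

theorem isYoung.antitoneOn {n k : ℕ} {lam : ℕ → ℕ} (hlam : isYoung n k lam) :
    AntitoneOn lam (Set.Icc 1 k) := by
  intro i hi j hj hij
  induction j, hij using Nat.le_induction with
  | base => exact le_rfl
  | succ j hij ih =>
    have := hi.1
    have := hj.2
    exact (hlam.2 j (by omega) (by omega)).trans (ih ⟨by omega, by omega⟩)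

theorem isGrassmannian.apply_eq {n k : ℕ} {x : Equiv.Perm ℕ} {lam : ℕ → ℕ}
    (hx : isGrassmannian n k x) (hlam : isYoung n k lam)
    (hvert : vert k lam = (Finset.Icc 1 k).image ⇑x) {i : ℕ} (h1 : 1 ≤ i) (hk : i ≤ k) :
    x i = lam (k + 1 - i) + i := by
  refine (eqOn_Icc_of_strictMonoOn_of_image_eq k (fun i => lam (k + 1 - i) + i) x ?_ ?_ hvert
    ⟨h1, hk⟩).symm
  · intro i hi j hj hij
    have hi' : 1 ≤ i ∧ i ≤ k := hi
    have hj' : 1 ≤ j ∧ j ≤ k := hj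
    have := hlam.antitoneOn (a := k + 1 - j) (b := k + 1 - i) ⟨by omega, by omega⟩
      ⟨by omega, by omega⟩ (by omega)
    dsimp only
    omega
  · exact fun i hi j hj hij => hx.2.1 i j hi.1 hij hj.2

theorem fixesOutside.apply_mem {n : ℕ} {x : Equiv.Perm ℕ} (hx : fixesOutside n x) {i : ℕ}
    (hi : i ∈ Finset.Icc 1 n) : x i ∈ Finset.Icc 1 n := by
  by_contra h
  exact h ((x.injective (hx _ h)).symm ▸ hi)

theorem colHeight_le (k : ℕ) (lam : ℕ → ℕ) (j : ℕ) : colHeight k lam j ≤ k :=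
  (Finset.card_filter_le _ _).trans (by simp)

theorem isYoung.le_colHeight {n k : ℕ} {lam : ℕ → ℕ} (hlam : isYoung n k lam) {r j : ℕ}
    (hrk : r ≤ k) (hj : j ≤ lam r) : r ≤ colHeight k lam j := by
  have hsub : Finset.Icc 1 r ⊆ (Finset.Icc 1 k).filter fun i => j ≤ lam i := by
    intro i hi
    rw [Finset.mem_Icc] at hi
    rw [Finset.mem_filter, Finset.mem_Icc]
    exact ⟨⟨hi.1, by omega⟩,
      hj.trans (hlam.antitoneOn ⟨hi.1, by omega⟩ ⟨by omega, hrk⟩ hi.2)⟩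
  simpa [colHeight] using Finset.card_le_card hsub

/-- The partial columnar word at a cell `(r, c)` maps `{1, …, k + c - r}` to
`{1, …, k - r} ∪ {k + 1, …, k + c}`. -/
theorem isYoung.image_colWord {n k r c : ℕ} {lam : ℕ → ℕ} (hlam : isYoung n k lam)
    (hrk : r ≤ k) (hc1 : 1 ≤ c) (hc : c ≤ lam r) :
    (Finset.Icc 1 (k + c - r)).image ⇑(colWord k lam r c) =
      Finset.Icc 1 (k - r) ∪ Finset.Icc (k + 1) (k + c) := by
  have hword : colWord k lam r c = ((List.range' 1 c).flatMap fun j =>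
      (List.range' 1 (if j = c then r else colHeight k lam j)).map fun i =>
        Equiv.swap (k + j - i) (k + j - i + 1)).prod := by
    obtain ⟨d, rfl⟩ := Nat.exists_eq_add_of_le' hc1
    rw [colWord, List.range'_1_concat, List.flatMap_append, List.flatMap_singleton,
      add_comm 1 d, if_pos rfl, Nat.add_sub_cancel]
    congr 2
    apply List.flatMap_congr
    intro j hj
    rw [List.mem_range'_1] at hj
    rw [if_neg (by omega)]
  rw [hword, show k + c - r = k - r + c by omega]
  apply image_prod_columns k (k - r) c (Nat.sub_le _ _)
  · intro j
    split_ifs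
    exacts [hrk, colHeight_le k lam j]
  · intro j _ hjc
    have := hlam.le_colHeight hrk (hjc.trans hc)
    split_ifs <;> omega

/-- At a frozen cell `(r, c)`, the Grassmannian permutation of `lam` maps
`{1, …, k - r} ∪ {k + 1, …, k + c}` onto `{1, …, k + c - r}`. -/
theorem isGrassmannian.image_of_frozen {n k r c : ℕ} {x : Equiv.Perm ℕ} {lam : ℕ → ℕ}
    (hkn : k < n) (hx : isGrassmannian n k x) (hlam : isYoung n k lam)
    (hvert : vert k lam = (Finset.Icc 1 k).image ⇑x)
    (hr1 : 1 ≤ r) (hrk : r ≤ k) (hc : c ≤ lam r)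
    (hfrozen : ¬(r + 1 ≤ k ∧ c + 1 ≤ lam (r + 1))) :
    (Finset.Icc 1 (k - r) ∪ Finset.Icc (k + 1) (k + c)).image ⇑x =
      Finset.Icc 1 (k + c - r) := by
  have hcn : c ≤ n - k :=
    hc.trans ((hlam.antitoneOn ⟨le_rfl, by omega⟩ ⟨hr1, hrk⟩ hr1).trans hlam.1)
  have hlast : c = 0 ∨ x (k + c) ≤ k + c - r := by
    by_contra! hlt
    have hsub : (Finset.Icc (k - r + 1) k ∪ Finset.Icc (k + c) n).image ⇑x ⊆
        Finset.Icc (k + c - r + 1) n := by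
      intro a ha
      obtain ⟨i, hi, rfl⟩ := Finset.mem_image.1 ha
      rw [Finset.mem_union, Finset.mem_Icc, Finset.mem_Icc] at hi
      have hmem := Finset.mem_Icc.1 (hx.1.apply_mem (Finset.mem_Icc.2
        (show 1 ≤ i ∧ i ≤ n by omega)))
      rw [Finset.mem_Icc]
      refine ⟨?_, hmem.2⟩
      rcases hi with hi | hi
      · have := hlam.antitoneOn (a := k + 1 - i) (b := r) ⟨by omega, by omega⟩ ⟨hr1, hrk⟩
          (by omega)
        rw [hx.apply_eq hlam hvert (by omega) hi.2]
        omega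
      · rcases hi.1.eq_or_lt with h | h
        · rw [← h]; omega
        · have := hx.2.2 (k + c) i (by omega) h hi.2
          omega
    have hcard := Finset.card_le_card hsub
    rw [Finset.card_image_of_injective _ x.injective, Finset.card_union_of_disjoint,
      Nat.card_Icc, Nat.card_Icc, Nat.card_Icc] at hcard
    · omega
    · rw [Finset.disjoint_left]
      intro a
      simp only [Finset.mem_Icc]
      omega
  apply Finset.eq_of_subset_of_card_le
  · intro a ha
    obtain ⟨i, hi, rfl⟩ := Finset.mem_image.1 ha
    rw [Finset.mem_union, Finset.mem_Icc, Finset.mem_Icc] at hi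
    have hmem := Finset.mem_Icc.1 (hx.1.apply_mem (Finset.mem_Icc.2
      (show 1 ≤ i ∧ i ≤ n by omega)))
    rw [Finset.mem_Icc]
    refine ⟨hmem.1, ?_⟩
    rcases hi with hi | hi
    · have := hlam.antitoneOn (a := r + 1) (b := k + 1 - i) ⟨by omega, by omega⟩
        ⟨by omega, by omega⟩ (by omega)
      rw [hx.apply_eq hlam hvert hi.1 (by omega)]
      omega
    · rcases hi.2.eq_or_lt with h | h
      · rw [h]; omega
      · have := hx.2.2 i (k + c) hi.1 h (by omega)
        omega
  · rw [Finset.card_image_of_injective _ x.injective, Finset.card_union_of_disjoint,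
      Nat.card_Icc, Nat.card_Icc, Nat.card_Icc]
    · omega
    · rw [Finset.disjoint_left]
      intro a
      simp only [Finset.mem_Icc]
      omega

/-- if `b = (r,c)` is a `λ`-frozen cell and `ℓ = k+c−r`, then for the
Grassmannian permutation `x` with `vert(λ) = x({1,…,k})`, we have
`w_b({1,…,ℓ}) = x⁻¹({1,…,ℓ})`. -/
theorem frozen_cell_partial_word_image (n k r c : ℕ)
    (hn : 2 ≤ n) (hk1 : 1 < k) (hkn : k < n)
    (x : Equiv.Perm ℕ) (hx : isGrassmannian n k x)
    (lam : ℕ → ℕ) (hlam : isYoung n k lam)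
    (hvert : vert k lam = (Finset.Icc 1 k).image ⇑x)
    (hr1 : 1 ≤ r) (hrk : r ≤ k) (hc1 : 1 ≤ c) (hc : c ≤ lam r)
    (hfrozen : ¬(r + 1 ≤ k ∧ c + 1 ≤ lam (r + 1))) :
    (Finset.Icc 1 (k + c - r)).image ⇑(colWord k lam r c) =
      (Finset.Icc 1 (k + c - r)).image ⇑x.symm := by
  rw [hlam.image_colWord hrk hc1 hc,
    ← hx.image_of_frozen hkn hlam hvert hr1 hrk hc hfrozen, Finset.image_image]
  simp
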